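/- arXiv:2402.16292 — 2 statements merged into one kernel-verified Lean document; each statement's English description precedes it below -/
import Mathlib

section
/- Let C ⊆ PΠ_{n,2} be a split closed order ideal and let π, μ ∈ C with |π| = |μ| = S for some S ⊆ Fin n. Then the common refinement π ∧ μ, the partial set partition of S whose blocks are the nonempty sets P ∩ M with P a block of π and M a block of μ, belongs to C. -/
/-- A partial set partition of `Fin n`: a finite set of nonempty, pairwise disjoint
subsets of `Fin n`, called its blocks. -/
structure PartialSetPartition (n : ℕ) where
  blocks : Finset (Finset (Fin n))
  nonempty_of_mem : ∀ B ∈ blocks, B.Nonempty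
  disjoint_of_ne : ∀ B ∈ blocks, ∀ B' ∈ blocks, B ≠ B' → Disjoint B B'

namespace PartialSetPartition

variable {n : ℕ}

/-- The ground set `|π|` of a partial set partition: the union of its blocks. -/
def ground (π : PartialSetPartition n) : Finset (Fin n) := π.blocks.sup id

/-- The order on `PΠ_n`: `τ ≤ π` iff `|τ| ⊆ |π|` and every nonempty set of the form
`P ∩ |τ|`, with `P` a block of `π`, is contained in some block of `τ`. -/
def Le (τ π : PartialSetPartition n) : Prop :=
  τ.ground ⊆ π.ground ∧
    ∀ P ∈ π.blocks, (P ∩ τ.ground).Nonempty → ∃ B ∈ τ.blocks, P ∩ τ.ground ⊆ B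

/-- Membership in `PΠ_{n,2}`: at least two blocks. -/
def TwoBlocks (π : PartialSetPartition n) : Prop := 2 ≤ π.blocks.card

/-- `ρ` is the splitting `π^τ` of `π` by the two-block partial set partition `τ`:
some block `B` of `π` equals the union of the two blocks of `τ` (i.e. `|τ|`), and `ρ` is
obtained from `π` by replacing `B` with the two blocks of `τ`. -/
def IsSplitting (π τ ρ : PartialSetPartition n) : Prop :=
  τ.blocks.card = 2 ∧
    ∃ B ∈ π.blocks, B = τ.ground ∧ ρ.blocks = (π.blocks.erase B) ∪ τ.blocks

/-- A split closed order ideal: a subset of `PΠ_{n,2}` that is downward closed for the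
order on `PΠ_n` and closed under splittings. -/
def IsSplitClosedIdeal (C : Set (PartialSetPartition n)) : Prop :=
  (∀ π ∈ C, TwoBlocks π) ∧
    (∀ π ∈ C, ∀ τ, TwoBlocks τ → Le τ π → τ ∈ C) ∧
    (∀ π ∈ C, ∀ τ ∈ C, ∀ ρ, IsSplitting π τ ρ → ρ ∈ C)

end PartialSetPartition

namespace PartialSetPartition

variable {n : ℕ}

theorem ext_blocks {π σ : PartialSetPartition n} (h : π.blocks = σ.blocks) : π = σ := by
  cases π
  cases σ
  simpa using h

theorem mem_ground {π : PartialSetPartition n} {x : Fin n} :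
    x ∈ π.ground ↔ ∃ B ∈ π.blocks, x ∈ B := by
  simp [ground, Finset.mem_sup]

theorem subset_ground {π : PartialSetPartition n} {B : Finset (Fin n)} (hB : B ∈ π.blocks) :
    B ⊆ π.ground := fun _ hx => mem_ground.2 ⟨B, hB, hx⟩

/-- Two blocks sharing a point are equal. -/
theorem eq_of_mem {π : PartialSetPartition n} {A B : Finset (Fin n)} (hA : A ∈ π.blocks)
    (hB : B ∈ π.blocks) {x : Fin n} (hxA : x ∈ A) (hxB : x ∈ B) : A = B := by
  by_contra h
  exact Finset.disjoint_left.1 (π.disjoint_of_ne A hA B hB h) hxA hxB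

/-- The two-block partial set partition `{A, B}`. -/
def pair (A B : Finset (Fin n)) (hA : A.Nonempty) (hB : B.Nonempty) (h : Disjoint A B) :
    PartialSetPartition n where
  blocks := {A, B}
  nonempty_of_mem := by
    simp only [Finset.mem_insert, Finset.mem_singleton]
    rintro C (rfl | rfl) <;> assumption
  disjoint_of_ne := by
    simp only [Finset.mem_insert, Finset.mem_singleton]
    rintro C (rfl | rfl) D (rfl | rfl) hne
    · exact absurd rfl hne
    · exact h
    · exact h.symm
    · exact absurd rfl hne

theorem card_pair {A B : Finset (Fin n)} (hA : A.Nonempty) (hB : B.Nonempty)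
    (h : Disjoint A B) : (pair A B hA hB h).blocks.card = 2 :=
  Finset.card_pair (h.ne hA.ne_empty)

theorem ground_pair {A B : Finset (Fin n)} (hA : A.Nonempty) (hB : B.Nonempty)
    (h : Disjoint A B) : (pair A B hA hB h).ground = A ∪ B := by
  simp [ground, pair]

/-- The partial set partition obtained from `π` by replacing its block `τ.ground` with the
blocks of `τ`. -/
def splitting (π τ : PartialSetPartition n) (hτ : τ.ground ∈ π.blocks) :
    PartialSetPartition n where
  blocks := (π.blocks.erase τ.ground) ∪ τ.blocks
  nonempty_of_mem := by
    simp only [Finset.mem_union, Finset.mem_erase]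
    rintro B (hB | hB)
    · exact π.nonempty_of_mem B hB.2
    · exact τ.nonempty_of_mem B hB
  disjoint_of_ne := by
    simp only [Finset.mem_union, Finset.mem_erase]
    rintro A (hA | hA) B (hB | hB) hne
    · exact π.disjoint_of_ne A hA.2 B hB.2 hne
    · exact (π.disjoint_of_ne A hA.2 _ hτ hA.1).mono_right (subset_ground hB)
    · exact (π.disjoint_of_ne B hB.2 _ hτ hB.1).symm.mono_left (subset_ground hA)
    · exact τ.disjoint_of_ne A hA B hB hne

theorem ground_splitting (π τ : PartialSetPartition n) (hτ : τ.ground ∈ π.blocks) :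
    (splitting π τ hτ).ground = π.ground := by
  have h : (splitting π τ hτ).ground = (π.blocks.erase τ.ground).sup id ∪ τ.ground := by
    simp [ground, splitting, Finset.sup_union]
  have h' : π.ground = (insert τ.ground (π.blocks.erase τ.ground)).sup id := by
    rw [Finset.insert_erase hτ, ground]
  rw [h, h', Finset.sup_insert, Finset.union_comm]
  rfl

theorem card_splitting (π τ : PartialSetPartition n) (hτ : τ.ground ∈ π.blocks)
    (hcard : τ.blocks.card = 2) :
    (splitting π τ hτ).blocks.card = π.blocks.card + 1 := by
  have hdisj : Disjoint (π.blocks.erase τ.ground) τ.blocks := by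
    refine Finset.disjoint_left.2 fun B hB hBτ => ?_
    obtain ⟨hne, hBπ⟩ := Finset.mem_erase.1 hB
    obtain ⟨x, hx⟩ := τ.nonempty_of_mem B hBτ
    exact hne (eq_of_mem hBπ hτ hx (subset_ground hBτ hx))
  have h := Finset.card_erase_add_one hτ
  rw [splitting, Finset.card_union_of_disjoint hdisj, hcard]
  omega

/-- `ρ` is the common refinement of `π` and `μ`. -/
def IsCommonRefinement (π μ ρ : PartialSetPartition n) : Prop :=
  ∀ B, B ∈ ρ.blocks ↔ B.Nonempty ∧ ∃ P ∈ π.blocks, ∃ M ∈ μ.blocks, P ∩ M = B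

/-- If every block of `π` lies in a block of `μ`, then `π` is its own common refinement
with `μ`. -/
theorem IsCommonRefinement.eq_of_forall_subset {π μ ρ : PartialSetPartition n}
    (hρ : IsCommonRefinement π μ ρ) (h : ∀ P ∈ π.blocks, ∃ M ∈ μ.blocks, P ⊆ M) : ρ = π := by
  refine ext_blocks (Finset.ext fun B => (hρ B).trans ⟨?_, fun hB => ?_⟩)
  · rintro ⟨⟨x, hx⟩, P, hP, M, hM, rfl⟩
    obtain ⟨N, hN, hPN⟩ := h P hP
    obtain ⟨hxP, hxM⟩ := Finset.mem_inter.1 hx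
    obtain rfl := eq_of_mem hM hN hxM (hPN hxP)
    rwa [Finset.inter_eq_left.2 hPN]
  · obtain ⟨M, hM, hBM⟩ := h B hB
    exact ⟨π.nonempty_of_mem B hB, B, hB, M, hM, Finset.inter_eq_left.2 hBM⟩

/-- A two-block partial set partition `{P ∩ M, P \ M}` with `M` a block of `μ` lies below
`μ`. -/
theorem pair_le {μ : PartialSetPartition n} {P M : Finset (Fin n)} (hM : M ∈ μ.blocks)
    (hP : P ⊆ μ.ground) (h₁ : (P ∩ M).Nonempty) (h₂ : (P \ M).Nonempty)
    (h : Disjoint (P ∩ M) (P \ M)) : Le (pair (P ∩ M) (P \ M) h₁ h₂ h) μ := by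
  have hground : (pair (P ∩ M) (P \ M) h₁ h₂ h).ground = P := by
    rw [ground_pair, Finset.union_comm, Finset.sdiff_union_inter]
  rw [Le, hground]
  refine ⟨hP, fun N hN _ => ?_⟩
  by_cases hNM : N = M
  · exact ⟨P ∩ M, by simp [pair], by rw [hNM, Finset.inter_comm]⟩
  · refine ⟨P \ M, by simp [pair], fun x hx => ?_⟩
    obtain ⟨hxN, hxP⟩ := Finset.mem_inter.1 hx
    exact Finset.mem_sdiff.2 ⟨hxP, fun hxM => hNM (eq_of_mem hN hM hxN hxM)⟩

/-- Splitting a block along a partial set partition above which `μ` lies does not change the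
common refinement with `μ`. -/
theorem IsCommonRefinement.splitting {π μ ρ τ : PartialSetPartition n}
    (hρ : IsCommonRefinement π μ ρ) (hτ : τ.ground ∈ π.blocks) (hle : Le τ μ) :
    IsCommonRefinement (splitting π τ hτ) μ ρ := by
  have key : ∀ M ∈ μ.blocks, ∀ x ∈ M, ∀ T ∈ τ.blocks, x ∈ T → T ∩ M = τ.ground ∩ M := by
    intro M hM x hxM T hT hxT
    have hx : x ∈ M ∩ τ.ground := Finset.mem_inter.2 ⟨hxM, subset_ground hT hxT⟩
    obtain ⟨U, hU, hMU⟩ := hle.2 M hM ⟨x, hx⟩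
    obtain rfl := eq_of_mem hT hU hxT (hMU hx)
    refine (Finset.inter_subset_inter_right (subset_ground hT)).antisymm fun y hy => ?_
    obtain ⟨hyτ, hyM⟩ := Finset.mem_inter.1 hy
    exact Finset.mem_inter.2 ⟨hMU (Finset.mem_inter.2 ⟨hyM, hyτ⟩), hyM⟩
  refine fun B => (hρ B).trans (and_congr_right fun hB => ⟨?_, ?_⟩)
  · rintro ⟨P, hP, M, hM, rfl⟩
    by_cases hPτ : P = τ.ground
    · subst hPτ
      obtain ⟨x, hx⟩ := hB
      obtain ⟨hxτ, hxM⟩ := Finset.mem_inter.1 hx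
      obtain ⟨T, hT, hxT⟩ := mem_ground.1 hxτ
      exact ⟨T, Finset.mem_union_right _ hT, M, hM, key M hM x hxM T hT hxT⟩
    · exact ⟨P, Finset.mem_union_left _ (Finset.mem_erase.2 ⟨hPτ, hP⟩), M, hM, rfl⟩
  · rintro ⟨P, hP, M, hM, rfl⟩
    rcases Finset.mem_union.1 hP with hP | hP
    · exact ⟨P, Finset.mem_of_mem_erase hP, M, hM, rfl⟩
    · obtain ⟨x, hx⟩ := hB
      obtain ⟨hxP, hxM⟩ := Finset.mem_inter.1 hx
      exact ⟨τ.ground, hτ, M, hM, (key M hM x hxM P hP hxP).symm⟩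

theorem IsSplitClosedIdeal.mem_of_isCommonRefinement {C : Set (PartialSetPartition n)}
    (hC : IsSplitClosedIdeal C) {π μ ρ : PartialSetPartition n} (hπ : π ∈ C) (hμ : μ ∈ C)
    (hground : π.ground = μ.ground) (hρ : IsCommonRefinement π μ ρ) : ρ ∈ C := by
  by_cases h : ∀ P ∈ π.blocks, ∃ M ∈ μ.blocks, P ⊆ M
  · rwa [hρ.eq_of_forall_subset h]
  push Not at h
  obtain ⟨P, hP, hPμ⟩ := h
  have hPS : P ⊆ μ.ground := hground ▸ subset_ground hP
  obtain ⟨x, hx⟩ := π.nonempty_of_mem P hP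
  obtain ⟨M, hM, hxM⟩ := mem_ground.1 (hPS hx)
  have h₁ : (P ∩ M).Nonempty := ⟨x, Finset.mem_inter.2 ⟨hx, hxM⟩⟩
  have h₂ : (P \ M).Nonempty := Finset.sdiff_nonempty.2 (hPμ M hM)
  have hdisj : Disjoint (P ∩ M) (P \ M) := (Finset.disjoint_sdiff_inter P M).symm
  let τ := pair (P ∩ M) (P \ M) h₁ h₂ hdisj
  have hτcard : τ.blocks.card = 2 := card_pair h₁ h₂ hdisj
  have hτP : τ.ground = P := by
    rw [ground_pair, Finset.union_comm, Finset.sdiff_union_inter]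
  have hle : Le τ μ := pair_le hM hPS h₁ h₂ hdisj
  have hτ : τ.ground ∈ π.blocks := hτP.symm ▸ hP
  have hτC : τ ∈ C := hC.2.1 μ hμ τ hτcard.ge hle
  have hσC : PartialSetPartition.splitting π τ hτ ∈ C :=
    hC.2.2 π hπ τ hτC _ ⟨hτcard, τ.ground, hτ, rfl, rfl⟩
  have hcard := card_splitting π τ hτ hτcard
  have hbound := Finset.card_le_univ (PartialSetPartition.splitting π τ hτ).blocks
  have hlt : Fintype.card (Finset (Fin n)) -
      (PartialSetPartition.splitting π τ hτ).blocks.card <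
        Fintype.card (Finset (Fin n)) - π.blocks.card := by omega
  exact hC.mem_of_isCommonRefinement hσC hμ ((ground_splitting π τ hτ).trans hground)
    (hρ.splitting hτ hle)
termination_by Fintype.card (Finset (Fin n)) - π.blocks.card
decreasing_by exact hlt

end PartialSetPartition

open PartialSetPartition in
/-- If `C` is a split closed order ideal and `π, μ ∈ C` have the same ground set `S`,
then the common refinement `π ∧ μ` — the partial set partition of `S` whose blocks are
the nonempty sets `P ∩ M` with `P` a block of `π` and `M` a block of `μ` — is in `C`. -/
theorem commonRefinement_mem
    {n : ℕ} (C : Set (PartialSetPartition n)) (hC : IsSplitClosedIdeal C)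
    (π μ : PartialSetPartition n) (hπ : π ∈ C) (hμ : μ ∈ C)
    (S : Finset (Fin n)) (hπS : π.ground = S) (hμS : μ.ground = S)
    (ρ : PartialSetPartition n)
    (hρ : ρ.blocks =
      ((π.blocks ×ˢ μ.blocks).image fun PM => PM.1 ∩ PM.2).filter fun B => B.Nonempty) :
    ρ ∈ C := by
  refine hC.mem_of_isCommonRefinement hπ hμ (hπS.trans hμS.symm) fun B => ?_
  simp only [hρ, Finset.mem_filter, Finset.mem_image, Finset.mem_product, Prod.exists]
  constructor
  · rintro ⟨⟨P, M, ⟨hP, hM⟩, rfl⟩, hB⟩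
    exact ⟨hB, P, hP, M, hM, rfl⟩
  · rintro ⟨hB, P, hP, M, hM, rfl⟩
    exact ⟨⟨P, M, ⟨hP, hM⟩, rfl⟩, hB⟩
end

section
/- Let C ⊆ PΠ_{n,2} be a split closed order ideal, and suppose γ assigns to each disconnected set D ⊆ Fin n an element γ_D ∈ C with |γ_D| = D that is greatest among elements of C with ground set D. Let φ be the ℝ-algebra homomorphism from ℝ[q_S : S ⊆ Fin n] to the polynomial ring ℝ[θ_T : T ⊆ Fin n connected with respect to C] defined by φ(q_S) = θ_S if S is connected and φ(q_D) = ∏_{B block of γ_D} θ_B if D is disconnected. Then the ideal J_C generated by the binomials q_D − ∏_{B block of γ_D} q_B, for all disconnected D, equals the kernel of φ. -/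
namespace PartialSetPartition

/-- A nonempty set `D` is disconnected with respect to `C` if `D` is the ground set of
some element of `C`; a set is connected if it is not disconnected. -/
def Disconnected {n : ℕ} (C : Set (PartialSetPartition n)) (D : Finset (Fin n)) : Prop :=
  ∃ π ∈ C, π.ground = D

end PartialSetPartition

namespace PartialSetPartition

variable {n : ℕ}

/-- The partition of a set into a nonempty proper subset and its complement. -/
def ofSSubset (A D : Finset (Fin n)) (hA : A.Nonempty) (hAD : A ⊂ D) :
    PartialSetPartition n where
  blocks := {A, D \ A}
  nonempty_of_mem := by
    simp only [Finset.mem_insert, Finset.mem_singleton, forall_eq_or_imp, forall_eq]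
    exact ⟨hA, Finset.sdiff_nonempty.2 hAD.2⟩
  disjoint_of_ne := by
    simp only [Finset.mem_insert, Finset.mem_singleton]
    rintro B (rfl | rfl) B' (rfl | rfl) h
    · exact absurd rfl h
    · exact Finset.disjoint_sdiff
    · exact Finset.sdiff_disjoint
    · exact absurd rfl h

theorem ground_ofSSubset {A D : Finset (Fin n)} (hA : A.Nonempty) (hAD : A ⊂ D) :
    (ofSSubset A D hA hAD).ground = D := by
  simp [ground, ofSSubset, Finset.union_eq_right.2 hAD.1]

theorem card_blocks_ofSSubset {A D : Finset (Fin n)} (hA : A.Nonempty) (hAD : A ⊂ D) :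
    (ofSSubset A D hA hAD).blocks.card = 2 := by
  refine Finset.card_pair fun h => ?_
  obtain ⟨x, hx⟩ := hA
  have hx' := hx
  rw [h] at hx'
  exact (Finset.mem_sdiff.1 hx').2 hx

theorem ssubset_ground_of_mem_blocks {π : PartialSetPartition n} (hπ : π.TwoBlocks)
    {A : Finset (Fin n)} (hA : A ∈ π.blocks) : A ⊂ π.ground := by
  refine ⟨subset_ground hA, fun h => ?_⟩
  obtain ⟨B, hB, hne⟩ := Finset.exists_mem_ne (Nat.lt_of_succ_le hπ) A
  obtain ⟨x, hx⟩ := π.nonempty_of_mem B hB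
  exact Finset.disjoint_left.1 (π.disjoint_of_ne B hB A hA hne) hx (h (subset_ground hB hx))

theorem ofSSubset_le {π : PartialSetPartition n} {A : Finset (Fin n)} (hA : A ∈ π.blocks)
    (hAπ : A ⊂ π.ground) : Le (ofSSubset A π.ground (π.nonempty_of_mem A hA) hAπ) π := by
  refine ⟨(ground_ofSSubset _ hAπ).subset, fun P hP _ => ?_⟩
  by_cases h : P = A
  · exact ⟨A, by simp [ofSSubset], Finset.inter_subset_left.trans h.subset⟩
  · refine ⟨π.ground \ A, by simp [ofSSubset], Finset.inter_subset_left.trans ?_⟩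
    exact Finset.subset_sdiff.2 ⟨subset_ground hP, π.disjoint_of_ne P hP A hA h⟩

/-- The refinement of a partial set partition obtained by splitting one block along `τ`. -/
def split (π τ : PartialSetPartition n) (h : τ.ground ∈ π.blocks) : PartialSetPartition n where
  blocks := π.blocks.erase τ.ground ∪ τ.blocks
  nonempty_of_mem := by
    intro B hB
    rcases Finset.mem_union.1 hB with hB | hB
    · exact π.nonempty_of_mem B (Finset.mem_of_mem_erase hB)
    · exact τ.nonempty_of_mem B hB
  disjoint_of_ne := by
    have key : ∀ B ∈ π.blocks.erase τ.ground, ∀ B' ∈ τ.blocks, Disjoint B B' := by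
      intro B hB B' hB'
      obtain ⟨hne, hB⟩ := Finset.mem_erase.1 hB
      exact (π.disjoint_of_ne B hB _ h hne).mono_right (subset_ground hB')
    intro B hB B' hB' hne
    rcases Finset.mem_union.1 hB with hB | hB <;> rcases Finset.mem_union.1 hB' with hB' | hB'
    · exact π.disjoint_of_ne B (Finset.mem_of_mem_erase hB) B' (Finset.mem_of_mem_erase hB') hne
    · exact key B hB B' hB'
    · exact (key B' hB' B hB).symm
    · exact τ.disjoint_of_ne B hB B' hB' hne

theorem ground_split {π τ : PartialSetPartition n} (h : τ.ground ∈ π.blocks) :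
    (split π τ h).ground = π.ground := by
  have : (split π τ h).ground = (insert τ.ground (π.blocks.erase τ.ground)).sup id := by
    simp [ground, split, Finset.sup_union, Finset.sup_insert, sup_comm]
  rw [this, Finset.insert_erase h, ground]

/-- The blocks of a greatest element of `C` with given ground set are connected. -/
theorem not_disconnected_of_mem_blocks {C : Set (PartialSetPartition n)}
    (hC : IsSplitClosedIdeal C) {π : PartialSetPartition n} (hπ : π ∈ C)
    (hmax : ∀ σ ∈ C, σ.ground = π.ground → Le σ π) {B : Finset (Fin n)}
    (hB : B ∈ π.blocks) : ¬ Disconnected C B := by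
  rintro ⟨σ, hσ, rfl⟩
  obtain ⟨hC₂, hCle, hCsplit⟩ := hC
  have hσ₂ := hC₂ σ hσ
  obtain ⟨A, hA⟩ : σ.blocks.Nonempty :=
    Finset.card_pos.1 (Nat.zero_lt_of_lt hσ₂)
  have hAσ := ssubset_ground_of_mem_blocks hσ₂ hA
  have hAne := σ.nonempty_of_mem A hA
  obtain ⟨τ, hτ⟩ : ∃ τ, τ = ofSSubset A σ.ground hAne hAσ := ⟨_, rfl⟩
  have hcard : τ.blocks.card = 2 := hτ ▸ card_blocks_ofSSubset hAne hAσ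
  have hground : τ.ground = σ.ground := hτ ▸ ground_ofSSubset hAne hAσ
  have hτC : τ ∈ C := hCle σ hσ τ hcard.ge (hτ ▸ ofSSubset_le hA hAσ)
  rw [← hground] at hB
  have hsplit : split π τ hB ∈ C := hCsplit π hπ τ hτC _ ⟨hcard, _, hB, rfl, rfl⟩
  have hle := (hmax _ hsplit (ground_split hB)).2 _ hB
  rw [ground_split, Finset.inter_eq_left.2 (subset_ground hB)] at hle
  have hne := π.nonempty_of_mem _ hB
  obtain ⟨E, hE, hsub⟩ := hle hne
  rcases Finset.mem_union.1 hE with hE | hE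
  · obtain ⟨hEne, hE⟩ := Finset.mem_erase.1 hE
    obtain ⟨x, hx⟩ := hne
    exact Finset.disjoint_left.1 (π.disjoint_of_ne _ hE _ hB hEne) (hsub hx) hx
  · exact (ssubset_ground_of_mem_blocks hcard.ge hE).2 hsub

end PartialSetPartition

/-- An ideal killed by `φ` is the kernel of `φ` if some `ψ` is a left inverse of `φ` on the
variables modulo the ideal. -/
theorem MvPolynomial.eq_ker_of_le_ker_of_X_sub_mem {R ι A : Type*} [CommRing R] [CommRing A]
    [Algebra R A] (I : Ideal (MvPolynomial ι R)) (φ : MvPolynomial ι R →ₐ[R] A)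
    (ψ : A →ₐ[R] MvPolynomial ι R) (hI : I ≤ RingHom.ker φ.toRingHom)
    (h : ∀ i, X i - ψ (φ (X i)) ∈ I) : I = RingHom.ker φ.toRingHom := by
  refine le_antisymm hI fun p hp => ?_
  have hcomp : Ideal.Quotient.mkₐ R I = ((Ideal.Quotient.mkₐ R I).comp ψ).comp φ :=
    MvPolynomial.algHom_ext fun i => by
      simpa using Ideal.Quotient.eq.2 (h i)
  have hp' : φ p = 0 := hp
  have := DFunLike.congr_fun hcomp p
  simp only [AlgHom.comp_apply, hp', map_zero] at this
  exact Ideal.Quotient.eq_zero_iff_mem.1 this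

open PartialSetPartition MvPolynomial in
open scoped Classical in
/-- Let `C` be a split closed order ideal and suppose `γ` assigns to each disconnected
set `D` a greatest element of `C` with ground set `D`.  Let
`φ : ℝ[q_S : S ⊆ Fin n] → ℝ[θ_T : T connected]` be the `ℝ`-algebra homomorphism with
`φ(q_S) = θ_S` for connected `S` and `φ(q_D) = ∏_{B block of γ_D} θ_B` for disconnected
`D` (every block of `γ_D` is connected, so the junk value `1` in the dite below is never
attained).  Then the ideal `J_C`, generated by the binomials
`q_D − ∏_{B block of γ_D} q_B` over all disconnected `D`, is the kernel of `φ`. -/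
theorem marginalIndependenceIdeal_eq_ker
    {n : ℕ} (C : Set (PartialSetPartition n)) (hC : IsSplitClosedIdeal C)
    (γ : Finset (Fin n) → PartialSetPartition n)
    (hγ : ∀ D : Finset (Fin n), Disconnected C D →
      γ D ∈ C ∧ (γ D).ground = D ∧ ∀ σ ∈ C, σ.ground = D → Le σ (γ D)) :
    Ideal.span {f : MvPolynomial (Finset (Fin n)) ℝ |
        ∃ D : Finset (Fin n), Disconnected C D ∧
          f = X D - ∏ B ∈ (γ D).blocks, X B} =
      RingHom.ker
        (MvPolynomial.aeval (R := ℝ)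
            (fun S : Finset (Fin n) =>
              if hS : Disconnected C S then
                ∏ B ∈ (γ S).blocks,
                  (if hB : ¬ Disconnected C B then
                      (X ⟨B, hB⟩ :
                        MvPolynomial {T : Finset (Fin n) // ¬ Disconnected C T} ℝ)
                    else 1)
              else X ⟨S, hS⟩)).toRingHom := by
  have hconn : ∀ D, Disconnected C D → ∀ B ∈ (γ D).blocks, ¬ Disconnected C B := by
    intro D hD B hB
    obtain ⟨hmem, hground, hmax⟩ := hγ D hD
    exact not_disconnected_of_mem_blocks hC hmem (fun σ hσ h => hmax σ hσ (h.trans hground)) hB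
  refine MvPolynomial.eq_ker_of_le_ker_of_X_sub_mem _ _
    (MvPolynomial.aeval fun T : {T : Finset (Fin n) // ¬ Disconnected C T} => X T.1) ?_ ?_
  · rw [Ideal.span_le]
    rintro _ ⟨D, hD, rfl⟩
    simp only [AlgHom.toRingHom_eq_coe, SetLike.mem_coe, RingHom.mem_ker, RingHom.coe_coe,
      map_sub, map_prod, aeval_X, dif_pos hD, sub_eq_zero]
    refine Finset.prod_congr rfl fun B hB => ?_
    simp [hconn D hD B hB]
  · intro S
    by_cases hS : Disconnected C S
    · refine Ideal.subset_span ⟨S, hS, ?_⟩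
      simp only [aeval_X, dif_pos hS, map_prod]
      congr 1
      refine Finset.prod_congr rfl fun B hB => ?_
      simp [hconn S hS B hB]
    · simp [hS]
end
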